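/- Let p be a prime number. For every integer m ≥ 2, τ_m([p/(p+1)]) − τ_{m−2}([p/(p+1)]) = (p^{m−1} + p^m) · [x_m], where x_m = (p/(p+1))·p^{−m}; in particular this divisor is effective and its support is the single point {(p/(p+1))·p^{−m}}. -/

import Mathlib

open Finsupp

/-- `x_k = (p/(p+1))·p^{-k}`. -/
noncomputable def xk (p k : ℕ) : ℝ := ((p : ℝ) / ((p : ℝ) + 1)) * (p : ℝ) ^ (-(k : ℤ))

/-- The value of the correspondence `τ₁` on the point divisor `[x]`. -/
noncomputable def tauOnePt (p : ℕ) (x : ℝ) : ℝ →₀ ℤ :=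
  if x ≤ 1 / ((p : ℝ) + 1) then
    Finsupp.single ((p : ℝ) * x) 1 + (p : ℤ) • Finsupp.single (x / (p : ℝ)) 1
  else
    Finsupp.single (1 - x) 1 + (p : ℤ) • Finsupp.single (x / (p : ℝ)) 1

/-- The correspondence `τ₁`, extended `ℤ`-linearly to divisors. -/
noncomputable def tauOne (p : ℕ) (D : ℝ →₀ ℤ) : ℝ →₀ ℤ :=
  D.sum fun x n => n • tauOnePt p x

/-- The correspondences `τ_m`: `τ₀ = id`, `τ₁` as above, and
`τ_m = τ₁ ∘ τ_{m-1} - p·τ_{m-2}` for `m ≥ 2`. -/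
noncomputable def tau (p : ℕ) : ℕ → (ℝ →₀ ℤ) → (ℝ →₀ ℤ)
  | 0 => id
  | 1 => tauOne p
  | (m + 2) => fun D => tauOne p (tau p (m + 1) D) - (p : ℤ) • tau p m D

/-- The degree of a divisor. -/
noncomputable def degDiv (D : ℝ →₀ ℤ) : ℤ := D.sum fun _ n => n

theorem tauOne_add (p : ℕ) (D E : ℝ →₀ ℤ) : tauOne p (D + E) = tauOne p D + tauOne p E :=
  Finsupp.sum_add_index' (fun _ => zero_smul _ _) fun _ _ _ => add_smul _ _ _

theorem tauOne_smul_single (p : ℕ) (c : ℤ) (x : ℝ) :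
    tauOne p (c • Finsupp.single x 1) = c • tauOnePt p x := by
  rw [Finsupp.smul_single, smul_eq_mul, mul_one]
  exact Finsupp.sum_single_index (zero_smul _ _)

theorem tauOne_single (p : ℕ) (x : ℝ) : tauOne p (Finsupp.single x 1) = tauOnePt p x := by
  simpa using tauOne_smul_single p 1 x

theorem xk_zero (p : ℕ) : xk p 0 = (p : ℝ) / ((p : ℝ) + 1) := by
  simp [xk]

theorem xk_one {p : ℕ} (hp : p ≠ 0) : xk p 1 = 1 / ((p : ℝ) + 1) := by
  have : (p : ℝ) ≠ 0 := by exact_mod_cast hp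
  simp only [xk, Nat.cast_one, zpow_neg_one]
  field_simp

theorem xk_succ {p : ℕ} (hp : p ≠ 0) (k : ℕ) : xk p (k + 1) = xk p k / p := by
  have : (p : ℝ) ≠ 0 := by exact_mod_cast hp
  simp only [xk, zpow_neg, zpow_natCast, pow_succ]
  field_simp

theorem xk_succ_le {p : ℕ} (hp : p ≠ 0) (k : ℕ) : xk p (k + 1) ≤ 1 / ((p : ℝ) + 1) := by
  have hp1 : (1 : ℝ) ≤ p := by exact_mod_cast Nat.one_le_iff_ne_zero.mpr hp
  induction k with
  | zero => exact (xk_one hp).le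
  | succ k ih =>
    rw [xk_succ hp]
    exact (div_le_self (by unfold xk; positivity) hp1).trans ih

theorem tauOnePt_xk_zero {p : ℕ} (hp : 1 < p) :
    tauOnePt p (xk p 0) = ((p : ℤ) + 1) • Finsupp.single (xk p 1) 1 := by
  have hp1 : (1 : ℝ) < p := by exact_mod_cast hp
  have hlt : ¬ xk p 0 ≤ 1 / ((p : ℝ) + 1) := by
    rw [xk_zero, not_le]
    gcongr
  have hsub : 1 - xk p 0 = xk p 1 := by
    rw [xk_zero, xk_one (by omega)]
    field_simp
    ring
  rw [tauOnePt, if_neg hlt, hsub, ← xk_succ (by omega)]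
  module

theorem tauOnePt_xk_succ {p : ℕ} (hp : p ≠ 0) (k : ℕ) :
    tauOnePt p (xk p (k + 1)) =
      Finsupp.single (xk p k) 1 + (p : ℤ) • Finsupp.single (xk p (k + 2)) 1 := by
  have hp0 : (p : ℝ) ≠ 0 := by exact_mod_cast hp
  rw [tauOnePt, if_pos (xk_succ_le hp k), ← xk_succ hp, xk_succ hp k, mul_div_cancel₀ _ hp0]

theorem tauOne_tau (p n : ℕ) (D : ℝ →₀ ℤ) :
    tauOne p (tau p (n + 1) D) = tau p (n + 2) D + (p : ℤ) • tau p n D := by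
  simp [tau]

theorem tau_add_two_single_xk_zero {p : ℕ} (hp : 1 < p) (n : ℕ) :
    tau p (n + 2) (Finsupp.single (xk p 0) 1) = tau p n (Finsupp.single (xk p 0) 1) +
      ((p : ℤ) ^ (n + 1) + (p : ℤ) ^ (n + 2)) • Finsupp.single (xk p (n + 2)) 1 := by
  have hp0 : p ≠ 0 := by omega
  have h1 : tau p 1 (Finsupp.single (xk p 0) 1) =
      ((p : ℤ) + 1) • Finsupp.single (xk p 1) 1 :=
    (tauOne_single p _).trans (tauOnePt_xk_zero hp)
  have h2 : tau p 2 (Finsupp.single (xk p 0) 1) = Finsupp.single (xk p 0) 1 +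
      ((p : ℤ) ^ 1 + (p : ℤ) ^ 2) • Finsupp.single (xk p 2) 1 := by
    rw [← add_left_inj ((p : ℤ) • tau p 0 (Finsupp.single (xk p 0) 1)), ← tauOne_tau, h1,
      tauOne_smul_single, tauOnePt_xk_succ hp0 0]
    simp only [tau, id]
    module
  induction n using Nat.twoStepInduction with
  | zero => exact h2
  | one =>
    rw [← add_left_inj ((p : ℤ) • tau p 1 (Finsupp.single (xk p 0) 1)), ← tauOne_tau, h2,
      tauOne_add, tauOne_single, tauOne_smul_single, tauOnePt_xk_zero hp,
      tauOnePt_xk_succ hp0 1, h1]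
    module
  | more n ih ih' =>
    rw [← add_left_inj ((p : ℤ) • tau p (n + 2) (Finsupp.single (xk p 0) 1)), ← tauOne_tau, ih',
      tauOne_add, tauOne_smul_single, tauOnePt_xk_succ hp0 (n + 2), tauOne_tau, ih]
    module

theorem stmt_5 (p : ℕ) (hp : p.Prime) (m : ℕ) (hm : 2 ≤ m) :
    tau p m (Finsupp.single ((p : ℝ) / ((p : ℝ) + 1)) 1)
          - tau p (m - 2) (Finsupp.single ((p : ℝ) / ((p : ℝ) + 1)) 1)
        = ((p : ℤ) ^ (m - 1) + (p : ℤ) ^ m) • Finsupp.single (xk p m) 1 ∧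
      (∀ y : ℝ,
        0 ≤ (tau p m (Finsupp.single ((p : ℝ) / ((p : ℝ) + 1)) 1)
              - tau p (m - 2) (Finsupp.single ((p : ℝ) / ((p : ℝ) + 1)) 1)) y) ∧
      (tau p m (Finsupp.single ((p : ℝ) / ((p : ℝ) + 1)) 1)
          - tau p (m - 2) (Finsupp.single ((p : ℝ) / ((p : ℝ) + 1)) 1)).support
        = {xk p m} := by
  have hp1 : 1 < p := hp.one_lt
  obtain ⟨n, rfl⟩ := Nat.exists_eq_add_of_le' hm
  have hc : 0 < (p : ℤ) ^ (n + 1) + (p : ℤ) ^ (n + 2) := by positivity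
  have key : tau p (n + 2) (Finsupp.single ((p : ℝ) / ((p : ℝ) + 1)) 1)
        - tau p (n + 2 - 2) (Finsupp.single ((p : ℝ) / ((p : ℝ) + 1)) 1)
      = ((p : ℤ) ^ (n + 2 - 1) + (p : ℤ) ^ (n + 2)) • Finsupp.single (xk p (n + 2)) 1 := by
    rw [← xk_zero, tau_add_two_single_xk_zero hp1]
    exact add_sub_cancel_left _ _
  refine ⟨key, fun y => ?_, ?_⟩
  · rw [key]
    exact mul_nonneg hc.le (Finsupp.single_nonneg.mpr zero_le_one y)
  · rw [key, Finsupp.smul_single, smul_eq_mul, mul_one]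
    exact Finsupp.support_single _ hc.ne'
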